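/- arXiv:2303.05945 — 3 statements merged into one kernel-verified Lean document; each statement's English description precedes it below -/
import Mathlib

section
/- For ζ ∈ ℝ and c > 0, the derivative ψ' of the function ψ(x) = φ((x−ζ)/c)·(x−ζ)·|x−ζ| is Lipschitz continuous on ℝ. -/
/-- The bump function `φ(u) = (1+u)³(1−u)³` for `|u| ≤ 1` and `φ(u) = 0` otherwise. -/
noncomputable def phi (u : ℝ) : ℝ := if |u| ≤ 1 then (1 + u) ^ 3 * (1 - u) ^ 3 else 0

/-- The function `ψ(x) = φ((x−ζ)/c)·(x−ζ)·|x−ζ|`. -/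
noncomputable def psi (ζ c x : ℝ) : ℝ := phi ((x - ζ) / c) * ((x - ζ) * |x - ζ|)

theorem hasDerivAt_max_zero_pow_three (y : ℝ) :
    HasDerivAt (fun y : ℝ => max 0 y ^ 3) (3 * max 0 y ^ 2) y := by
  refine hasDerivAt_of_hasDerivAt_of_ne' (x := 0) (g := fun y : ℝ => 3 * max 0 y ^ 2)
    (fun z hz => ?_) (by fun_prop) (by fun_prop) y
  rcases lt_or_gt_of_ne hz with h | h
  · rw [max_eq_left h.le]
    refine ((hasDerivAt_const z (0 : ℝ)).congr_of_eventuallyEq ?_).congr_deriv (by norm_num)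
    filter_upwards [gt_mem_nhds h] with w hw
    simp [max_eq_left hw.le]
  · rw [max_eq_right h.le]
    refine ((hasDerivAt_pow 3 z).congr_of_eventuallyEq ?_).congr_deriv (by norm_num)
    filter_upwards [lt_mem_nhds h] with w hw
    simp [max_eq_right hw.le]

theorem hasDerivAt_mul_abs (y : ℝ) : HasDerivAt (fun y : ℝ => y * |y|) (2 * |y|) y := by
  refine hasDerivAt_of_hasDerivAt_of_ne' (x := 0) (g := fun y : ℝ => 2 * |y|)
    (fun z hz => ?_) (by fun_prop) (by fun_prop) y
  refine ((hasDerivAt_id z).mul (hasDerivAt_abs hz)).congr_deriv ?_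
  rcases lt_or_gt_of_ne hz with h | h
  · simp [h, abs_of_neg h]; ring
  · simp [h, abs_of_pos h]; ring

theorem phi_eq_max_pow_three (u : ℝ) : phi u = max 0 (1 - u ^ 2) ^ 3 := by
  unfold phi
  split_ifs with h
  · rw [max_eq_right (by linarith [(sq_le_one_iff_abs_le_one u).2 h])]
    ring
  · rw [max_eq_left (by linarith [not_le.1 (mt (sq_le_one_iff_abs_le_one u).1 h)])]
    norm_num

theorem hasDerivAt_phi_mul_mul_abs (u : ℝ) :
    HasDerivAt (fun u : ℝ => phi u * (u * |u|))
      ((fun s : ℝ => s * (1 - s ^ 2) ^ 2 * (2 - 8 * s ^ 2)) (min 1 |u|)) u := by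
  simp only [phi_eq_max_pow_three]
  have hin : HasDerivAt (fun u : ℝ => 1 - u ^ 2) (-(2 * u)) u := by
    simpa using (hasDerivAt_pow 2 u).const_sub 1
  refine (((hasDerivAt_max_zero_pow_three (1 - u ^ 2)).comp u hin).mul
    (hasDerivAt_mul_abs u)).congr_deriv ?_
  simp only [Function.comp_apply]
  rcases le_total |u| 1 with h | h
  · rw [min_eq_right h, max_eq_right (by linarith [(sq_le_one_iff_abs_le_one u).2 h]), sq_abs]
    ring
  · rw [min_eq_left h, max_eq_left (by linarith [(one_le_sq_iff_one_le_abs u).2 h])]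
    norm_num

theorem psi_eq_sq_mul (ζ c x : ℝ) (hc : 0 < c) :
    psi ζ c x = c ^ 2 * (phi ((x - ζ) / c) * ((x - ζ) / c * |(x - ζ) / c|)) := by
  rw [psi, abs_div, abs_of_pos hc]
  field_simp

theorem deriv_psi (ζ c x : ℝ) (hc : 0 < c) :
    deriv (psi ζ c) x =
      c * (fun s : ℝ => s * (1 - s ^ 2) ^ 2 * (2 - 8 * s ^ 2)) (min 1 |(x - ζ) / c|) := by
  rw [funext fun x => psi_eq_sq_mul ζ c x hc]
  have hin : HasDerivAt (fun x : ℝ => (x - ζ) / c) (1 / c) x :=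
    ((hasDerivAt_id x).sub_const ζ).div_const c
  refine (((hasDerivAt_phi_mul_mul_abs ((x - ζ) / c)).comp x hin).const_mul (c ^ 2)).deriv.trans ?_
  field_simp

theorem exists_lipschitzOnWith_Icc_poly :
    ∃ K, LipschitzOnWith K (fun s : ℝ => s * (1 - s ^ 2) ^ 2 * (2 - 8 * s ^ 2))
      (Set.Icc 0 1) :=
  ContDiffOn.exists_lipschitzOnWith (n := 1) (by fun_prop) one_ne_zero (convex_Icc 0 1)
    isCompact_Icc

/-- For `ζ ∈ ℝ` and `c > 0`, the derivative `ψ'` of `ψ` is Lipschitz continuous on `ℝ`. -/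
theorem stmt5 (ζ c : ℝ) (hc : 0 < c) :
    ∃ K : NNReal, LipschitzWith K (deriv (psi ζ c)) := by
  obtain ⟨K, hK⟩ := exists_lipschitzOnWith_Icc_poly
  refine ⟨K, LipschitzWith.of_dist_le_mul fun x y => ?_⟩
  have hmem (z : ℝ) : min 1 |z| ∈ Set.Icc (0 : ℝ) 1 :=
    ⟨le_min zero_le_one (abs_nonneg z), min_le_left _ _⟩
  have hmin : |min 1 (|(x - ζ) / c|) - min 1 (|(y - ζ) / c|)| ≤ |x - y| / c := by
    calc |min 1 (|(x - ζ) / c|) - min 1 (|(y - ζ) / c|)|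
        ≤ |(|(x - ζ) / c| - |(y - ζ) / c|)| := by
          simpa using abs_min_sub_min_le_max 1 |(x - ζ) / c| 1 |(y - ζ) / c|
      _ ≤ |(x - ζ) / c - (y - ζ) / c| := abs_abs_sub_abs_le _ _
      _ = |x - y| / c := by
          rw [← sub_div, abs_div, abs_of_pos hc, sub_sub_sub_cancel_right]
  have hq := hK.dist_le_mul _ (hmem ((x - ζ) / c)) _ (hmem ((y - ζ) / c))
  rw [Real.dist_eq, Real.dist_eq] at hq
  rw [deriv_psi ζ c x hc, deriv_psi ζ c y hc, Real.dist_eq, Real.dist_eq, ← mul_sub, abs_mul,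
    abs_of_pos hc]
  calc _ ≤ c * (K * (|x - y| / c)) := by
        gcongr
        exact hq.trans (by gcongr)
    _ = K * |x - y| := by field_simp
end

section
/- For ζ ∈ ℝ and c > 0, the function ψ(x) = φ((x−ζ)/c)·(x−ζ)·|x−ζ| is twice differentiable at every x ≠ ζ, and its second derivative ψ'' satisfies lim_{x→ζ, x>ζ} ψ''(x) = 2 and lim_{x→ζ, x<ζ} ψ''(x) = −2. -/
open Filter Set

theorem hasDerivAt_max_zero_pow (n : ℕ) (t : ℝ) :
    HasDerivAt (fun t : ℝ => max t 0 ^ (n + 2)) ((n + 2) * max t 0 ^ (n + 1)) t := by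
  refine hasDerivAt_of_hasDerivAt_of_ne' (x := 0)
    (g := fun t : ℝ => ((n : ℝ) + 2) * max t 0 ^ (n + 1)) (fun y hy => ?_)
    (by fun_prop) (by fun_prop) t
  rcases lt_or_gt_of_ne hy with h | h
  · have he : (fun t : ℝ => max t 0 ^ (n + 2)) =ᶠ[nhds y] fun _ => 0 := by
      filter_upwards [Iio_mem_nhds h] with z hz
      simp [max_eq_right (le_of_lt (mem_Iio.1 hz))]
    simpa [max_eq_right h.le] using (hasDerivAt_const y (0 : ℝ)).congr_of_eventuallyEq he
  · have he : (fun t : ℝ => max t 0 ^ (n + 2)) =ᶠ[nhds y] fun t => t ^ (n + 2) := by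
      filter_upwards [Ioi_mem_nhds h] with z hz
      rw [max_eq_left (le_of_lt (mem_Ioi.1 hz))]
    refine ((hasDerivAt_pow (n + 2) y).congr_of_eventuallyEq he).congr_deriv ?_
    simp [max_eq_left h.le]

theorem hasDerivAt_mul_abs_self (t : ℝ) : HasDerivAt (fun t : ℝ => t * |t|) (2 * |t|) t := by
  refine hasDerivAt_of_hasDerivAt_of_ne' (x := 0) (g := fun t : ℝ => 2 * |t|) (fun y hy => ?_)
    (by fun_prop) (by fun_prop) t
  refine ((hasDerivAt_id y).mul (hasDerivAt_abs hy)).congr_deriv ?_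
  have := self_mul_sign y
  simp only [id]
  linarith

theorem phi_eq_max_pow (u : ℝ) : phi u = max (1 - u ^ 2) 0 ^ 3 := by
  unfold phi
  split_ifs with h
  · rw [max_eq_left (sub_nonneg.2 ((sq_le_one_iff_abs_le_one u).2 h))]
    ring
  · rw [max_eq_right (sub_nonpos.2 ((one_lt_sq_iff_one_lt_abs u).2 (not_le.1 h)).le)]
    norm_num

theorem hasDerivAt_one_sub_sq (u : ℝ) : HasDerivAt (fun u : ℝ => 1 - u ^ 2) (-(2 * u)) u := by
  simpa using (hasDerivAt_pow 2 u).const_sub 1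

theorem hasDerivAt_phi (u : ℝ) : HasDerivAt phi (-6 * u * max (1 - u ^ 2) 0 ^ 2) u := by
  rw [funext phi_eq_max_pow]
  refine ((hasDerivAt_max_zero_pow 1 (1 - u ^ 2)).comp u (hasDerivAt_one_sub_sq u)).congr_deriv ?_
  push_cast
  ring

theorem hasDerivAt_deriv_phi (u : ℝ) :
    HasDerivAt (fun u : ℝ => -6 * u * max (1 - u ^ 2) 0 ^ 2)
      (-6 * max (1 - u ^ 2) 0 ^ 2 + 24 * u ^ 2 * max (1 - u ^ 2) 0) u := by
  refine (((hasDerivAt_id u).const_mul (-6)).mul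
    ((hasDerivAt_max_zero_pow 0 (1 - u ^ 2)).comp u (hasDerivAt_one_sub_sq u))).congr_deriv ?_
  simp only [id, Function.comp]
  push_cast
  ring

theorem hasDerivAt_sub_div (ζ c x : ℝ) : HasDerivAt (fun x : ℝ => (x - ζ) / c) (1 / c) x :=
  ((hasDerivAt_id x).sub_const ζ).div_const c

theorem hasDerivAt_psi (ζ c x : ℝ) :
    HasDerivAt (psi ζ c)
      (-6 * ((x - ζ) / c) * max (1 - ((x - ζ) / c) ^ 2) 0 ^ 2 * (1 / c) * ((x - ζ) * |x - ζ|) +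
        phi ((x - ζ) / c) * (2 * |x - ζ|)) x :=
  ((hasDerivAt_phi _).comp x (hasDerivAt_sub_div ζ c x)).mul
    ((hasDerivAt_mul_abs_self (x - ζ)).comp_sub_const x ζ)

/-- The part of the second derivative of `psi ζ c` that is continuous at `ζ`. -/
noncomputable def psiSecondRegular (ζ c x : ℝ) : ℝ :=
  (-6 * max (1 - ((x - ζ) / c) ^ 2) 0 ^ 2 +
      24 * ((x - ζ) / c) ^ 2 * max (1 - ((x - ζ) / c) ^ 2) 0) * (1 / c) * (1 / c) *
      ((x - ζ) * |x - ζ|) +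
    2 * (-6 * ((x - ζ) / c) * max (1 - ((x - ζ) / c) ^ 2) 0 ^ 2 * (1 / c) * (2 * |x - ζ|))

theorem hasDerivAt_deriv_psi (ζ c : ℝ) {x : ℝ} (hx : x ≠ ζ) :
    HasDerivAt (deriv (psi ζ c))
      (psiSecondRegular ζ c x + phi ((x - ζ) / c) * (2 * SignType.sign (x - ζ))) x := by
  rw [funext fun x => (hasDerivAt_psi ζ c x).deriv]
  have hu := hasDerivAt_sub_div ζ c x
  have habs := ((hasDerivAt_abs (sub_ne_zero.2 hx)).comp_sub_const x ζ).const_mul 2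
  refine (((((hasDerivAt_deriv_phi _).comp x hu).mul_const (1 / c)).mul
    ((hasDerivAt_mul_abs_self (x - ζ)).comp_sub_const x ζ)).add
    (((hasDerivAt_phi _).comp x hu).mul habs)).congr_deriv ?_
  simp only [psiSecondRegular, Function.comp]
  ring

theorem tendsto_psiSecondRegular_add (ζ c s : ℝ) :
    Tendsto (fun x => psiSecondRegular ζ c x + phi ((x - ζ) / c) * (2 * s))
      (nhds ζ) (nhds (2 * s)) := by
  have hcont : Continuous fun x => psiSecondRegular ζ c x + phi ((x - ζ) / c) * (2 * s) := by
    simp only [psiSecondRegular, phi_eq_max_pow]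
    fun_prop
  simpa [psiSecondRegular, phi_eq_max_pow] using hcont.tendsto ζ

/-- For `ζ ∈ ℝ` and `c > 0`, the function `ψ` is twice differentiable at every `x ≠ ζ`,
and its second derivative satisfies `lim_{x→ζ+} ψ''(x) = 2` and `lim_{x→ζ−} ψ''(x) = −2`. -/
theorem stmt6 (ζ c : ℝ) (hc : 0 < c) :
    (∀ x : ℝ, x ≠ ζ →
        DifferentiableAt ℝ (psi ζ c) x ∧ DifferentiableAt ℝ (deriv (psi ζ c)) x) ∧
      Tendsto (deriv (deriv (psi ζ c))) (nhdsWithin ζ (Ioi ζ)) (nhds 2) ∧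
      Tendsto (deriv (deriv (psi ζ c))) (nhdsWithin ζ (Iio ζ)) (nhds (-2)) := by
  refine ⟨fun x hx => ⟨(hasDerivAt_psi ζ c x).differentiableAt,
    (hasDerivAt_deriv_psi ζ c hx).differentiableAt⟩, ?_, ?_⟩
  · have h := (tendsto_psiSecondRegular_add ζ c 1).mono_left
      (nhdsWithin_le_nhds (s := Ioi ζ))
    rw [mul_one] at h
    refine h.congr' ?_
    filter_upwards [self_mem_nhdsWithin] with x hx
    rw [(hasDerivAt_deriv_psi ζ c (ne_of_gt hx)).deriv, sign_pos (sub_pos.2 hx)]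
    simp
  · have h := (tendsto_psiSecondRegular_add ζ c (-1)).mono_left
      (nhdsWithin_le_nhds (s := Iio ζ))
    rw [mul_neg_one] at h
    refine h.congr' ?_
    filter_upwards [self_mem_nhdsWithin] with x hx
    rw [(hasDerivAt_deriv_psi ζ c (ne_of_lt hx)).deriv, sign_neg (sub_neg.2 hx)]
    simp
end

section
/- The inverse function G⁻¹: ℝ → ℝ of G is Lipschitz continuous, with Lipschitz constant 1/(1 − 6c·max_{1≤j≤k}|α_j|). -/
open Filter Set

/-- The transformation `G(x) = x + Σ_{j=1}^k α_j φ((x−ζ_j)/c)(x−ζ_j)|x−ζ_j|`. -/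
noncomputable def Gfun (k : ℕ) (ζ α : Fin k → ℝ) (c : ℝ) (x : ℝ) : ℝ :=
  x + ∑ j : Fin k, α j * (phi ((x - ζ j) / c) * ((x - ζ j) * |x - ζ j|))

lemma phi_eq_zero_of_one_le {u : ℝ} (hu : 1 ≤ |u|) : phi u = 0 := by
  unfold phi
  split_ifs with h
  · have h1 : u ^ 2 = 1 := by rw [← sq_abs, le_antisymm h hu, one_pow]
    have : (1 + u) ^ 3 * (1 - u) ^ 3 = (1 - u ^ 2) ^ 3 := by ring
    rw [this, h1]
    norm_num
  · rfl

lemma abs_mul_one_sub_pow_sub_le {a b : ℝ} (ha : a ∈ Icc (0 : ℝ) 1) (hb : b ∈ Icc (0 : ℝ) 1) :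
    |a * (1 - a) ^ 3 - b * (1 - b) ^ 3| ≤ |a - b| := by
  have hd : ∀ t ∈ Icc (0 : ℝ) 1, HasDerivWithinAt (fun t : ℝ => t * (1 - t) ^ 3)
      ((1 - t) ^ 2 * (1 - 4 * t)) (Icc 0 1) t := by
    intro t _
    have h := (hasDerivAt_id t).mul (((hasDerivAt_id t).const_sub 1).pow 3)
    refine (h.congr_deriv ?_).hasDerivWithinAt
    simp only [id]
    push_cast
    norm_num
    ring
  have hbound : ∀ t ∈ Icc (0 : ℝ) 1, ‖(1 - t) ^ 2 * (1 - 4 * t)‖ ≤ 1 := by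
    rintro t ⟨h0, h1⟩
    rw [Real.norm_eq_abs, abs_le]
    constructor
    · nlinarith [mul_nonneg h0 (sub_nonneg.2 h1), mul_nonneg h0 (sq_nonneg (1 - t)),
        mul_nonneg h0 (sq_nonneg (2 * t - 1)), mul_nonneg h0 (sq_nonneg (t - 1 / 3))]
    · have h2 : (1 - t) ^ 2 ≤ 1 := by nlinarith
      nlinarith [mul_nonneg h0 (sq_nonneg (1 - t))]
  simpa using (convex_Icc (0 : ℝ) 1).norm_image_sub_le_of_norm_hasDerivWithin_le hd hbound hb ha

lemma abs_phi_mul_sub_le_of_mem_Icc {u v : ℝ} (hu : u ∈ Icc (-1 : ℝ) 1)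
    (hv : v ∈ Icc (-1 : ℝ) 1) :
    |phi u * (u * |u|) - phi v * (v * |v|)| ≤ 3 * |u - v| := by
  have hphi : ∀ w ∈ Icc (-1 : ℝ) 1, phi w = (1 - w ^ 2) ^ 3 := by
    intro w hw
    rw [phi, if_pos (abs_le.2 hw)]
    ring
  have hsq : ∀ w ∈ Icc (-1 : ℝ) 1, w ^ 2 ∈ Icc (0 : ℝ) 1 := fun w hw =>
    ⟨sq_nonneg w, by nlinarith [hw.1, hw.2]⟩
  have hkey := abs_mul_one_sub_pow_sub_le (hsq u hu) (hsq v hv)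
  have hfac : |u ^ 2 - v ^ 2| ≤ 3 * |u - v| := by
    have h : u ^ 2 - v ^ 2 = (u + v) * (u - v) := by ring
    rw [h, abs_mul]
    refine mul_le_mul_of_nonneg_right ?_ (abs_nonneg _)
    rw [abs_le]
    constructor <;> linarith [hu.1, hu.2, hv.1, hv.2]
  have hle : ∀ w ∈ Icc (-1 : ℝ) 1, 0 ≤ w ^ 2 * (1 - w ^ 2) ^ 3 ∧
      w ^ 2 * (1 - w ^ 2) ^ 3 ≤ |w| := by
    intro w hw
    obtain ⟨h0, h1⟩ := hsq w hw
    have h2 : 0 ≤ 1 - w ^ 2 := by linarith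
    have h3 : (1 - w ^ 2) ^ 3 ≤ 1 := pow_le_one₀ h2 (by linarith)
    refine ⟨by positivity, ?_⟩
    have h4 : w ^ 2 ≤ |w| := by
      rw [← sq_abs]
      nlinarith [abs_nonneg w, abs_le.2 hw]
    nlinarith
  obtain ⟨hu0, hu1⟩ := hle u hu
  obtain ⟨hv0, hv1⟩ := hle v hv
  rw [hphi u hu, hphi v hv]
  rcases le_total 0 u with hu' | hu' <;> rcases le_total 0 v with hv' | hv'
  · rw [abs_of_nonneg hu', abs_of_nonneg hv']
    refine Eq.trans_le (congrArg abs ?_) (hkey.trans hfac)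
    ring
  · rw [abs_of_nonneg hu'] at hu1 ⊢
    rw [abs_of_nonpos hv'] at hv1 ⊢
    rw [abs_of_nonneg (by linarith : 0 ≤ u - v), abs_le]
    constructor <;> nlinarith
  · rw [abs_of_nonpos hu'] at hu1 ⊢
    rw [abs_of_nonneg hv'] at hv1 ⊢
    rw [abs_of_nonpos (by linarith : u - v ≤ 0), abs_le]
    constructor <;> nlinarith
  · rw [abs_of_nonpos hu', abs_of_nonpos hv']
    rw [abs_sub_comm] at hkey
    refine Eq.trans_le (congrArg abs ?_) (hkey.trans hfac)
    ring

lemma abs_phi_mul_sub_le (u v : ℝ) :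
    |phi u * (u * |u|) - phi v * (v * |v|)| ≤ 3 * |u - v| := by
  have hmem : ∀ w : ℝ, max (-1) (min 1 w) ∈ Icc (-1 : ℝ) 1 := fun w =>
    ⟨le_max_left _ _, max_le (by norm_num) (min_le_left _ _)⟩
  have hclamp : ∀ w : ℝ, phi (max (-1) (min 1 w)) * (max (-1) (min 1 w) *
      |max (-1) (min 1 w)|) = phi w * (w * |w|) := by
    intro w
    rcases le_total 1 w with h | h
    · rw [min_eq_left h, max_eq_right (by norm_num), phi_eq_zero_of_one_le (by simp),
        phi_eq_zero_of_one_le (h.trans (le_abs_self w)), zero_mul, zero_mul]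
    rw [min_eq_right h]
    rcases le_total w (-1) with h' | h'
    · rw [max_eq_left h', phi_eq_zero_of_one_le (by simp),
        phi_eq_zero_of_one_le (by linarith [neg_le_abs w]), zero_mul, zero_mul]
    · rw [max_eq_right h']
  have hlip : |max (-1) (min 1 u) - max (-1) (min 1 v)| ≤ |u - v| := by
    refine (abs_max_sub_max_le_max _ _ _ _).trans (max_le (by simp) ?_)
    exact (abs_min_sub_min_le_max _ _ _ _).trans (max_le (by simp) le_rfl)
  have h := abs_phi_mul_sub_le_of_mem_Icc (hmem u) (hmem v)
  rw [hclamp, hclamp] at h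
  linarith

lemma abs_phi_div_mul_sub_le {c : ℝ} (hc : 0 < c) (s t : ℝ) :
    |phi (s / c) * (s * |s|) - phi (t / c) * (t * |t|)| ≤ 3 * c * |s - t| := by
  have hscale : ∀ r : ℝ, phi (r / c) * (r * |r|) = c ^ 2 * (phi (r / c) * (r / c * |r / c|)) := by
    intro r
    rw [abs_div, abs_of_pos hc]
    field_simp
  rw [hscale s, hscale t, ← mul_sub, abs_mul, abs_of_pos (by positivity)]
  refine (mul_le_mul_of_nonneg_left (abs_phi_mul_sub_le _ _) (by positivity)).trans_eq ?_
  rw [← sub_div, abs_div, abs_of_pos hc]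
  field_simp

lemma card_filter_abs_sub_lt_le_one {k : ℕ} {ζ : Fin k → ℝ} {c : ℝ}
    (hsep : ∀ i j, i < j → 2 * c < ζ j - ζ i) (x : ℝ) :
    (Finset.univ.filter fun j => |x - ζ j| < c).card ≤ 1 := by
  rw [Finset.card_le_one]
  intro i hi j hj
  simp only [Finset.mem_filter, Finset.mem_univ, true_and, abs_lt] at hi hj
  rcases lt_trichotomy i j with h | h | h
  · linarith [hsep i j h]
  · exact h
  · linarith [hsep j i h]

lemma phi_div_eq_zero {c s : ℝ} (hc : 0 < c) (hs : ¬ |s| < c) : phi (s / c) = 0 := by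
  refine phi_eq_zero_of_one_le ?_
  rw [abs_div, abs_of_pos hc, one_le_div hc]
  exact not_lt.1 hs

/-- At most two summands of the perturbation term of `G` change between `x` and `y`, each of them
being Lipschitz with constant `3cM`. -/
lemma le_abs_Gfun_sub {k : ℕ} {ζ α : Fin k → ℝ} {c M : ℝ} (hc : 0 < c) (hM0 : 0 ≤ M)
    (hM : ∀ j, |α j| ≤ M) (hsep : ∀ i j, i < j → 2 * c < ζ j - ζ i) (x y : ℝ) :
    (1 - 6 * c * M) * |x - y| ≤ |Gfun k ζ α c x - Gfun k ζ α c y| := by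
  set F : Fin k → ℝ → ℝ :=
    fun j x => α j * (phi ((x - ζ j) / c) * ((x - ζ j) * |x - ζ j|)) with hF
  have hterm : ∀ j, |F j x - F j y| ≤ M * (3 * c * |x - y|) := by
    intro j
    simp only [hF]
    rw [← mul_sub, abs_mul]
    have h := abs_phi_div_mul_sub_le hc (x - ζ j) (y - ζ j)
    rw [sub_sub_sub_cancel_right] at h
    exact mul_le_mul (hM j) h (abs_nonneg _) hM0
  set S := (Finset.univ.filter fun j => |x - ζ j| < c) ∪
    (Finset.univ.filter fun j => |y - ζ j| < c) with hS
  have hcard : (S.card : ℝ) ≤ 2 := by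
    have h := Finset.card_union_le (Finset.univ.filter fun j => |x - ζ j| < c)
      (Finset.univ.filter fun j => |y - ζ j| < c)
    have hx := card_filter_abs_sub_lt_le_one hsep x
    have hy := card_filter_abs_sub_lt_le_one hsep y
    exact_mod_cast h.trans (add_le_add hx hy)
  have hsum : ∑ j, (F j x - F j y) = ∑ j ∈ S, (F j x - F j y) := by
    refine (Finset.sum_subset (Finset.subset_univ S) fun j _ hj => ?_).symm
    simp only [hS, Finset.mem_union, Finset.mem_filter, Finset.mem_univ, true_and,
      not_or] at hj
    simp [hF, phi_div_eq_zero hc hj.1, phi_div_eq_zero hc hj.2]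
  have hbound : |∑ j, (F j x - F j y)| ≤ 6 * c * M * |x - y| := by
    rw [hsum]
    calc |∑ j ∈ S, (F j x - F j y)| ≤ ∑ j ∈ S, |F j x - F j y| := Finset.abs_sum_le_sum_abs _ _
      _ ≤ S.card • (M * (3 * c * |x - y|)) := Finset.sum_le_card_nsmul _ _ _ fun j _ => hterm j
      _ ≤ 2 * (M * (3 * c * |x - y|)) := by
        rw [nsmul_eq_mul]
        exact mul_le_mul_of_nonneg_right hcard (by positivity)
      _ = 6 * c * M * |x - y| := by ring
  have hG : Gfun k ζ α c x - Gfun k ζ α c y = (x - y) + ∑ j, (F j x - F j y) := by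
    rw [Finset.sum_sub_distrib]
    simp only [Gfun, hF]
    ring
  rw [hG]
  have h := abs_sub_abs_le_abs_sub (x - y) (-∑ j, (F j x - F j y))
  rw [abs_neg, sub_neg_eq_add] at h
  linarith

/-- The global inverse `G⁻¹` of `G` is Lipschitz continuous with
Lipschitz constant `1/(1 − 6c·max_j |α_j|)`. -/
theorem stmt11 (k : ℕ) (ζ α : Fin k → ℝ) (hζ : StrictMono ζ) (c : ℝ) (hc : 0 < c)
    (hα : ∀ j : Fin k, α j ≠ 0 → c < 1 / (6 * |α j|))
    (hsep : ∀ (j : ℕ) (h : j + 1 < k), c < (ζ ⟨j + 1, h⟩ - ζ ⟨j, by omega⟩) / 2)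
    (Ginv : ℝ → ℝ) (hGinv₁ : Function.LeftInverse Ginv (Gfun k ζ α c))
    (hGinv₂ : Function.RightInverse Ginv (Gfun k ζ α c)) :
    ∀ x y : ℝ,
      |Ginv x - Ginv y| ≤ (1 / (1 - 6 * c * ⨆ j : Fin k, |α j|)) * |x - y| := by
  have hsep' : ∀ i j, i < j → 2 * c < ζ j - ζ i := by
    intro i j hij
    have hlt : (i : ℕ) + 1 < k := lt_of_le_of_lt hij j.2
    have h1 := hsep i hlt
    have h2 : ζ ⟨i + 1, hlt⟩ ≤ ζ j := hζ.monotone hij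
    simp only [Fin.eta] at h1
    linarith
  have hM : ∀ j, |α j| ≤ ⨆ j : Fin k, |α j| :=
    le_ciSup (f := fun j => |α j|) (Set.finite_range _).bddAbove
  have hM0 : 0 ≤ ⨆ j : Fin k, |α j| := Real.iSup_nonneg fun j => abs_nonneg _
  have hpos : 0 < 1 - 6 * c * ⨆ j : Fin k, |α j| := by
    rcases isEmpty_or_nonempty (Fin k) with _ | _
    · simp
    obtain ⟨j, hj⟩ := exists_eq_ciSup_of_finite (f := fun j : Fin k => |α j|)
    rw [← hj]
    by_cases h0 : α j = 0
    · simp [h0]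
    · have h := hα j h0
      rw [lt_div_iff₀ (by positivity)] at h
      linarith
  intro x y
  have h := le_abs_Gfun_sub hc hM0 hM hsep' (Ginv x) (Ginv y)
  rw [hGinv₂ x, hGinv₂ y] at h
  rwa [one_div_mul_eq_div, le_div_iff₀' hpos]
end
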